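/- Let n ≥ 2 and N ≥ 1, let U ⊆ ℝⁿ be open and connected, and let (A₁,…,A_n, V) be a semilinear elliptic first-order system respecting the zero section on U. Let φ : U → ℝ^N be a smooth solution of ∑ⱼ Aⱼ(x)(∂φ/∂xⱼ)(x) + V(x, φ(x)) = 0 with φ not identically zero. Then N_fin(φ), the set of zeros of φ of finite order, is countably (n−2)-C∞-rectifiable; in particular its Hausdorff dimension satisfies dimH(N_fin(φ)) ≤ n − 2. -/

import Mathlib

open MeasureTheory Metric Set Filter Topology ENNReal NNReal

noncomputable section

/-- `m`-dimensional Euclidean space. -/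
abbrev Euc (m : ℕ) := EuclideanSpace ℝ (Fin m)

/-- The semilinear first-order differential operator `φ ↦ ∑ⱼ Aⱼ(x) ∂φ/∂xⱼ + V(x, φ(x))`
applied to `φ` at the point `x`. -/
def semilinApply {n N : ℕ} (A : Fin n → Euc n → Matrix (Fin N) (Fin N) ℝ)
    (V : Euc n → (Fin N → ℝ) → (Fin N → ℝ)) (φ : Euc n → (Fin N → ℝ)) (x : Euc n) :
    Fin N → ℝ :=
  (∑ j, (A j x).mulVec (fderiv ℝ φ x (EuclideanSpace.single j 1))) + V x (φ x)

/-- Ellipticity of the principal symbol `ξ ↦ ∑ⱼ ξⱼ Aⱼ(x)` at every point of `U`. -/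
def IsElliptic {n N : ℕ} (A : Fin n → Euc n → Matrix (Fin N) (Fin N) ℝ)
    (U : Set (Euc n)) : Prop :=
  ∀ x ∈ U, ∀ ξ : Euc n, ξ ≠ 0 → IsUnit (∑ j, ξ j • A j x)

/-- A set `S ⊆ ℝⁿ` is countably `m`-`C^∞`-rectifiable if it is contained in a countable
union of ranges of smooth maps `ℝᵐ → ℝⁿ`. -/
def CountablyCinfRectifiable {n : ℕ} (m : ℕ) (S : Set (Euc n)) : Prop :=
  ∃ g : ℕ → (Euc m → Euc n), (∀ i, ContDiff ℝ (⊤ : ℕ∞) (g i)) ∧ S ⊆ ⋃ i, range (g i)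


/-- The implicit function theorem, in parametrized form: near a point where `g` has surjective
derivative, the zero set of `g` is contained in the range of a globally defined smooth map. -/
theorem exists_contDiff_zeroSet_subset_range {E F : Type*} [NormedAddCommGroup E]
    [NormedSpace ℝ E] [FiniteDimensional ℝ E] [NormedAddCommGroup F] [NormedSpace ℝ F]
    [FiniteDimensional ℝ F] {m : ℕ} (hdim : Module.finrank ℝ E = Module.finrank ℝ F + m)
    {g : E → F} {p : E} (hg : ∀ᶠ x in 𝓝 p, ContDiffAt ℝ (⊤ : ℕ∞) g x)
    (hsurj : Function.Surjective (fderiv ℝ g p)) :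
    ∃ h : Euc m → E, ContDiff ℝ (⊤ : ℕ∞) h ∧ ∃ W ∈ 𝓝 p, W ∩ {x | g x = 0} ⊆ range h := by
  have : CompleteSpace E := FiniteDimensional.complete ℝ E
  set L := fderiv ℝ g p
  have hker : Module.finrank ℝ (LinearMap.ker L.toLinearMap) = m := by
    have h1 := LinearMap.finrank_range_add_finrank_ker L.toLinearMap
    rw [LinearMap.range_eq_top.2 hsurj, finrank_top, hdim] at h1
    omega
  obtain ⟨e⟩ : Nonempty (LinearMap.ker L.toLinearMap ≃L[ℝ] Euc m) :=
    FiniteDimensional.nonempty_continuousLinearEquiv_of_finrank_eq (by simp [hker])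
  obtain ⟨q, hq⟩ := (LinearMap.ker L.toLinearMap).subtype.exists_leftInverse_of_injective
    (Submodule.ker_subtype _)
  let R : E →L[ℝ] Euc m := LinearMap.toContinuousLinearMap (e.toLinearMap ∘ₗ q)
  have hinj : Function.Injective (L.prod R).toLinearMap := by
    rw [← LinearMap.ker_eq_bot, LinearMap.ker_eq_bot']
    intro x hx
    have h1 : L x = 0 := congrArg Prod.fst hx
    have h2 : e (q x) = 0 := congrArg Prod.snd hx
    have h3 : q x = ⟨x, h1⟩ := DFunLike.congr_fun hq ⟨x, h1⟩
    rw [h3, map_eq_zero_iff _ e.injective] at h2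
    exact congrArg Subtype.val h2
  let T : E ≃L[ℝ] F × Euc m :=
    (LinearMap.linearEquivOfInjective _ hinj (by simp [hdim])).toContinuousLinearEquiv
  let Φ : E → F × Euc m := fun x => (g x, R x)
  have hΦ : ∀ᶠ x in 𝓝 p, ContDiffAt ℝ (⊤ : ℕ∞) Φ x :=
    hg.mono fun x hx => hx.prodMk R.contDiff.contDiffAt
  have hTΦ : HasFDerivAt Φ (T : E →L[ℝ] F × Euc m) p :=
    ((hg.self_of_nhds.differentiableAt (by simp)).hasFDerivAt).prodMk R.hasFDerivAt
  have hinv : ∀ᶠ x in 𝓝 p, fderiv ℝ Φ x ∈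
      range ((↑) : (E ≃L[ℝ] F × Euc m) → E →L[ℝ] F × Euc m) := by
    refine (hΦ.self_of_nhds.fderiv_right (m := 0) (by simp)).continuousAt.eventually_mem ?_
    rw [hTΦ.fderiv]
    exact ContinuousLinearEquiv.nhds T
  obtain ⟨O, hO, hOopen, hpO⟩ := _root_.eventually_nhds_iff.1 (hΦ.and hinv)
  let Ψ := (hΦ.self_of_nhds.toOpenPartialHomeomorph Φ hTΦ (by simp)).restrOpen O hOopen
  have hpΨ : p ∈ Ψ.source :=
    ⟨hΦ.self_of_nhds.mem_toOpenPartialHomeomorph_source hTΦ (by simp), hpO⟩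
  have hΨ : ∀ x, Ψ x = Φ x := fun x => rfl
  have hsymm : ∀ y ∈ Ψ.target, ContDiffAt ℝ (⊤ : ℕ∞) Ψ.symm y := by
    intro y hy
    have hyO : Ψ.symm y ∈ O := (Ψ.map_target hy).2
    obtain ⟨h1, S, hS⟩ := hO _ hyO
    refine Ψ.contDiffAt_symm (f₀' := S) hy ?_ h1
    rw [hS]
    exact (h1.differentiableAt (by simp)).hasFDerivAt
  by_cases hp : g p = 0
  · have hnhds : ∀ᶠ z in 𝓝 (R p), ((0 : F), z) ∈ Ψ.target := by
      refine (Continuous.prodMk_right (0 : F)).continuousAt.eventually_mem ?_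
      refine Ψ.open_target.mem_nhds ?_
      have := Ψ.map_source hpΨ
      rwa [hΨ, show Φ p = (0, R p) by simp [Φ, hp]] at this
    obtain ⟨r, hr, hball⟩ := Metric.eventually_nhds_iff_ball.1 hnhds
    let b := OpenPartialHomeomorph.univBall (R p) r
    have hb : ∀ z, b z ∈ ball (R p) r := fun z => by
      rw [← OpenPartialHomeomorph.univBall_target (R p) hr]
      exact b.map_source (by simp [b])
    refine ⟨fun z => Ψ.symm (0, b z), contDiff_iff_contDiffAt.2 fun z => ?_,
      Ψ.source ∩ R ⁻¹' ball (R p) r, ?_, ?_⟩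
    · exact (hsymm _ (hball _ (hb z))).comp z
        (contDiffAt_const.prodMk OpenPartialHomeomorph.contDiff_univBall.contDiffAt)
    · exact inter_mem (Ψ.open_source.mem_nhds hpΨ)
        (R.continuous.continuousAt.preimage_mem_nhds (ball_mem_nhds _ hr))
    · rintro x ⟨⟨hx, hxb⟩, hx0⟩
      have hxt : R x ∈ b.target := by
        rwa [OpenPartialHomeomorph.univBall_target (R p) hr]
      refine ⟨b.symm (R x), ?_⟩
      have hl := Ψ.left_inv hx
      rw [hΨ, show Φ x = (0, R x) from congrArg (·, R x) hx0] at hl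
      simpa only [b.right_inv hxt] using hl
  · exact ⟨fun _ => 0, contDiff_const, {x | g x ≠ 0},
      hg.self_of_nhds.continuousAt.eventually_ne hp, fun x hx => absurd hx.2 hx.1⟩

/-- The first slot of an iterated derivative is a directional derivative of the previous one. -/
theorem iteratedFDeriv_succ_apply_eq_fderiv {E F : Type*} [NormedAddCommGroup E]
    [NormedSpace ℝ E] [NormedAddCommGroup F] [NormedSpace ℝ F] {f : E → F} {x : E}
    (hf : ContDiffAt ℝ (⊤ : ℕ∞) f x) {m : ℕ} (v : Fin (m + 1) → E) :
    iteratedFDeriv ℝ (m + 1) f x v =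
      fderiv ℝ (fun y => iteratedFDeriv ℝ m f y (Fin.tail v)) x (v 0) := by
  have hit : ContDiffAt ℝ (⊤ : ℕ∞) (iteratedFDeriv ℝ m f) x :=
    hf.iteratedFDeriv_right (by exact_mod_cast le_top)
  rw [iteratedFDeriv_succ_apply_left]
  have h := ((ContinuousMultilinearMap.apply ℝ (fun _ : Fin m => E) F
    (Fin.tail v)).hasFDerivAt.comp x (hit.differentiableAt (by simp)).hasFDerivAt).fderiv
  exact (DFunLike.congr_fun h (v 0)).symm

/-- Evaluating an iterated derivative at fixed directions preserves smoothness. -/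
theorem contDiffAt_iteratedFDeriv_apply {E F : Type*} [NormedAddCommGroup E]
    [NormedSpace ℝ E] [NormedAddCommGroup F] [NormedSpace ℝ F] {f : E → F} {x : E}
    (hf : ContDiffAt ℝ (⊤ : ℕ∞) f x) {m : ℕ} (v : Fin m → E) :
    ContDiffAt ℝ (⊤ : ℕ∞) (fun y => iteratedFDeriv ℝ m f y v) x :=
  (ContinuousMultilinearMap.apply ℝ (fun _ : Fin m => E) F v).contDiff.contDiffAt.comp x
    (hf.iteratedFDeriv_right (by exact_mod_cast le_top))

/-- Differentiating first or last in an iterated derivative gives the same result. -/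
theorem iteratedFDeriv_fderiv_apply {E F : Type*} [NormedAddCommGroup E]
    [NormedSpace ℝ E] [NormedAddCommGroup F] [NormedSpace ℝ F] {U : Set E} (hU : IsOpen U)
    {f : E → F} (hf : ContDiffOn ℝ (⊤ : ℕ∞) f U) (w : E) (m : ℕ) :
    ∀ x ∈ U, ∀ v : Fin m → E, iteratedFDeriv ℝ m (fderiv ℝ f) x v w =
      fderiv ℝ (fun y => iteratedFDeriv ℝ m f y v) x w := by
  have hat : ∀ x ∈ U, ContDiffAt ℝ (⊤ : ℕ∞) f x := fun x hx => hf.contDiffAt (hU.mem_nhds hx)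
  induction m with
  | zero =>
    intro x hx v
    simp
  | succ m ih =>
    intro x hx v
    set h : E → F := fun y => iteratedFDeriv ℝ m f y (Fin.tail v)
    have hfd : ContDiffAt ℝ (⊤ : ℕ∞) (iteratedFDeriv ℝ m (fderiv ℝ f)) x :=
      ((hat x hx).fderiv_right (m := (⊤ : ℕ∞)) (by simp)).iteratedFDeriv_right
        (by exact_mod_cast le_top)
    have hhd : DifferentiableAt ℝ (fderiv ℝ h) x :=
      ((contDiffAt_iteratedFDeriv_apply (hat x hx) _).fderiv_right (m := (⊤ : ℕ∞)) (by simp)).differentiableAt (by simp)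
    have hsw : ∀ a b, fderiv ℝ (fun y => fderiv ℝ h y a) x b = fderiv ℝ (fderiv ℝ h) x b a := by
      intro a b
      have := ((ContinuousLinearMap.apply ℝ F a).hasFDerivAt.comp x hhd.hasFDerivAt).fderiv
      exact DFunLike.congr_fun this b
    have h1 : iteratedFDeriv ℝ (m + 1) (fderiv ℝ f) x v w =
        fderiv ℝ (fun y => iteratedFDeriv ℝ m (fderiv ℝ f) y (Fin.tail v) w) x (v 0) := by
      rw [iteratedFDeriv_succ_apply_left]
      have := (((ContinuousLinearMap.apply ℝ F w).comp (ContinuousMultilinearMap.apply ℝ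
        (fun _ : Fin m => E) (E →L[ℝ] F) (Fin.tail v))).hasFDerivAt.comp x
          (hfd.differentiableAt (by simp)).hasFDerivAt).fderiv
      exact (DFunLike.congr_fun this (v 0)).symm
    have h2 : (fun y => iteratedFDeriv ℝ m (fderiv ℝ f) y (Fin.tail v) w) =ᶠ[𝓝 x]
        fun y => fderiv ℝ h y w :=
      eventually_of_mem (hU.mem_nhds hx) fun y hy => ih y hy _
    have h3 : (fun y => iteratedFDeriv ℝ (m + 1) f y v) =ᶠ[𝓝 x] fun y => fderiv ℝ h y (v 0) :=
      eventually_of_mem (hU.mem_nhds hx) fun y hy => iteratedFDeriv_succ_apply_eq_fderiv (hat y hy) v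
    rw [h1, h2.fderiv_eq, h3.fderiv_eq, hsw, hsw]
    exact (contDiffAt_iteratedFDeriv_apply (hat x hx) _).isSymmSndFDerivAt
      (by simpa using (by exact_mod_cast le_top : ((2 : ℕ∞) : WithTop ℕ∞) ≤ (⊤ : ℕ∞))) _ _

/-- If `f` vanishes to order `m` at `p`, only the leading term of the Leibniz formula for the
`m`-th derivative of `a • f` survives at `p`. -/
theorem iteratedFDeriv_smul_of_vanishing {E F : Type*} [NormedAddCommGroup E]
    [NormedSpace ℝ E] [NormedAddCommGroup F] [NormedSpace ℝ F] {U : Set E} (hU : IsOpen U)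
    {a : E → ℝ} {f : E → F} (ha : ContDiffOn ℝ (⊤ : ℕ∞) a U) (hf : ContDiffOn ℝ (⊤ : ℕ∞) f U)
    {p : E} (hp : p ∈ U) {m : ℕ} (hv : ∀ i < m, iteratedFDeriv ℝ i f p = 0) :
    iteratedFDeriv ℝ m (fun x => a x • f x) p = a p • iteratedFDeriv ℝ m f p := by
  have hU' : U ∈ 𝓝 p := hU.mem_nhds hp
  have hb : ContDiffOn ℝ (⊤ : ℕ∞) (fun x => a x - a p) U := ha.sub contDiffOn_const
  have h0 : iteratedFDeriv ℝ m (fun x => (a x - a p) • f x) p = 0 := by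
    have h := (ContinuousLinearMap.lsmul ℝ ℝ :
      ℝ →L[ℝ] F →L[ℝ] F).norm_iteratedFDerivWithin_le_of_bilinear
      hb hf hU.uniqueDiffOn hp (n := m) (by exact_mod_cast le_top)
    rw [iteratedFDerivWithin_of_isOpen _ hU hp] at h
    rw [← norm_le_zero_iff]
    refine h.trans (le_of_eq ?_)
    rw [Finset.sum_eq_zero, mul_zero]
    intro i _
    rcases Nat.eq_zero_or_pos i with rfl | hi
    · simp
    · rcases Nat.lt_or_ge (m - i) m with hlt | hge
      · rw [iteratedFDerivWithin_of_isOpen (m - i) hU hp, hv _ hlt, norm_zero, mul_zero]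
      · have : i ≤ m := by simp_all
        omega
  have hsplit : (fun x => a x • f x) = (fun x => (a x - a p) • f x) + a p • f := by
    ext x; simp [sub_smul]
  have hf' : ContDiffAt ℝ m f p := (hf.contDiffAt hU').of_le (by exact_mod_cast le_top)
  have hbf : ContDiffAt ℝ m (fun x => (a x - a p) • f x) p :=
    ((hb.smul hf).contDiffAt hU').of_le (by exact_mod_cast le_top)
  have haf : ContDiffAt ℝ m (a p • f) p := hf'.const_smul (a p)
  rw [hsplit, iteratedFDeriv_add_apply hbf haf, h0,
    iteratedFDeriv_const_smul_apply hf', zero_add]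

/-- If `F` vanishes on the zero section and `f` vanishes to order `m + 1` at `p`, then the `m`-th
derivative of `x ↦ F (x, f x)` vanishes at `p`. -/
theorem iteratedFDeriv_comp_section_eq_zero {E F G : Type*} [NormedAddCommGroup E]
    [NormedSpace ℝ E] [NormedAddCommGroup F] [NormedSpace ℝ F] [NormedAddCommGroup G]
    [NormedSpace ℝ G] {V : E × F → G} {f : E → F} {p : E} {m : ℕ}
    (hV : ContDiffAt ℝ m V (p, 0)) (hf : ContDiffAt ℝ m f p)
    (hV0 : ∀ᶠ x in 𝓝 p, V (x, 0) = 0) (hv : ∀ i ≤ m, iteratedFDeriv ℝ i f p = 0) :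
    iteratedFDeriv ℝ m (fun x => V (x, f x)) p = 0 := by
  have hfp : f p = 0 := by
    have := congrArg (fun M => M 0) (hv 0 (Nat.zero_le _))
    simpa using this
  have h0 : iteratedFDeriv ℝ m (V ∘ fun x => (x, (0 : F))) p = 0 := by
    have : (V ∘ fun x => (x, (0 : F))) =ᶠ[𝓝 p] 0 := hV0
    rw [(this.iteratedFDeriv ℝ m).self_of_nhds]
    simp
  have hc : ContDiffAt ℝ m (fun x : E => (x, (0 : F))) p := contDiffAt_id.prodMk contDiffAt_const
  have hs : ContDiffAt ℝ m (fun x : E => (x, f x)) p := contDiffAt_id.prodMk hf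
  rw [iteratedFDeriv_comp (f := fun x => (x, (0 : F))) hV hc le_rfl] at h0
  rw [← h0]
  change iteratedFDeriv ℝ m (V ∘ fun x => (x, f x)) p = _
  rw [iteratedFDeriv_comp (f := fun x => (x, f x)) (by simpa [hfp] using hV) hs le_rfl, hfp]
  have hjet : ∀ i ≤ m, ftaylorSeries ℝ (fun x => (x, f x)) p i =
      ftaylorSeries ℝ (fun x => (x, (0 : F))) p i := by
    intro i hi
    simp only [ftaylorSeries]
    have hi' : ((i : ℕ∞) : WithTop ℕ∞) ≤ (m : ℕ∞) := by exact_mod_cast hi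
    rw [iteratedFDeriv_prodMk contDiffAt_fun_id hf hi', iteratedFDeriv_prodMk contDiffAt_fun_id
      contDiffAt_const hi', hv i hi]
    congr 1
    exact (congrFun (iteratedFDeriv_fun_zero (𝕜 := ℝ) (E := E) (F := F) (n := i)) p).symm
  refine Finset.sum_congr rfl fun c _ => ?_
  simp only [FormalMultilinearSeries.compAlongOrderedFinpartition]
  congr 1
  ext1 i
  exact hjet _ (c.partSize_le i)

/-- A nonzero linear map annihilated by an elliptic symbol has rank at least two. -/
theorem exists_surjective_comp_of_elliptic {n N : ℕ} {A : Fin n → Matrix (Fin N) (Fin N) ℝ}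
    (hell : ∀ ξ : Euc n, ξ ≠ 0 → IsUnit (∑ j, ξ j • A j))
    {L : Euc n →ₗ[ℝ] (Fin N → ℝ)} (hL : L ≠ 0)
    (hAL : ∑ j, (A j).mulVec (L (EuclideanSpace.single j 1)) = 0) :
    ∃ P : (Fin N → ℝ) →ₗ[ℝ] (Fin 2 → ℝ), Function.Surjective (P ∘ₗ L) := by
  have hrank : 2 ≤ Module.finrank ℝ (LinearMap.range L) := by
    by_contra! hlt
    obtain ⟨w, hw⟩ := finrank_le_one_iff.1 (Nat.lt_succ_iff.1 hlt)
    choose c hc using fun j => hw (L.rangeRestrict (EuclideanSpace.single j 1))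
    have hc' : ∀ j, L (EuclideanSpace.single j 1) = c j • (w : Fin N → ℝ) := fun j =>
      (congrArg Subtype.val (hc j)).symm
    have hcne : WithLp.toLp 2 c ≠ (0 : Euc n) := by
      intro h0
      refine hL ((EuclideanSpace.basisFun (Fin n) ℝ).toBasis.ext fun j => ?_)
      have : c j = 0 := congrArg (fun ξ : Euc n => ξ j) h0
      simp [hc', this]
    have hwne : (w : Fin N → ℝ) ≠ 0 := by
      intro h0
      refine hL ((EuclideanSpace.basisFun (Fin n) ℝ).toBasis.ext fun j => ?_)
      simp [hc', h0]
    refine hwne (Matrix.mulVec_injective_of_isUnit (hell _ hcne) ?_)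
    rw [Matrix.mulVec_zero, ← hAL, Matrix.sum_mulVec]
    exact Finset.sum_congr rfl fun j _ => by
      rw [hc', Matrix.mulVec_smul, Matrix.smul_mulVec]
  obtain ⟨f, hf⟩ : ∃ f : LinearMap.range L →ₗ[ℝ] (Fin 2 → ℝ), Function.Surjective f := by
    let e := (Module.finBasis ℝ (LinearMap.range L)).equivFun
    exact ⟨LinearMap.funLeft ℝ ℝ (Fin.castLE hrank) ∘ₗ e.toLinearMap,
      (LinearMap.funLeft_surjective_of_injective ℝ ℝ _ (Fin.castLE_injective hrank)).comp
        e.surjective⟩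
  obtain ⟨P, hP⟩ := f.exists_extend
  refine ⟨P, fun y => ?_⟩
  obtain ⟨⟨_, x, rfl⟩, hx⟩ := hf y
  exact ⟨x, by rw [← hx, ← hP]; rfl⟩

/-- Near a zero `p` of order exactly `m + 1`, the zero set of the `m`-th derivative of a solution
is contained in the range of a smooth map from a space of codimension two. -/
theorem exists_contDiff_iteratedFDeriv_zeroSet_subset_range {n N : ℕ} (hn : 2 ≤ n)
    {U : Set (Euc n)} (hU : IsOpen U)
    {A : Fin n → Euc n → Matrix (Fin N) (Fin N) ℝ}
    (hA : ∀ j i l, ContDiffOn ℝ (⊤ : ℕ∞) (fun x => A j x i l) U)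
    (hell : IsElliptic A U)
    {V : Euc n → (Fin N → ℝ) → (Fin N → ℝ)}
    (hV : ContDiffOn ℝ (⊤ : ℕ∞) (fun p : Euc n × (Fin N → ℝ) => V p.1 p.2) (U ×ˢ univ))
    (hV0 : ∀ x ∈ U, V x 0 = 0)
    {φ : Euc n → (Fin N → ℝ)} (hφ : ContDiffOn ℝ (⊤ : ℕ∞) φ U)
    (heq : ∀ x ∈ U, semilinApply A V φ x = 0) {p : Euc n} (hp : p ∈ U) {m : ℕ}
    (hv : ∀ i ≤ m, iteratedFDeriv ℝ i φ p = 0) (hne : iteratedFDeriv ℝ (m + 1) φ p ≠ 0) :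
    ∃ h : Euc (n - 2) → Euc n, ContDiff ℝ (⊤ : ℕ∞) h ∧
      ∃ W ∈ 𝓝 p, W ∩ {x | iteratedFDeriv ℝ m φ x = 0} ⊆ range h := by
  have hU' : U ∈ 𝓝 p := hU.mem_nhds hp
  have hat : ∀ x ∈ U, ContDiffAt ℝ (⊤ : ℕ∞) φ x := fun x hx => hφ.contDiffAt (hU.mem_nhds hx)
  obtain ⟨u, hu⟩ : ∃ u, iteratedFDeriv ℝ (m + 1) φ p u ≠ 0 := by
    by_contra! h
    exact hne (ContinuousMultilinearMap.ext h)
  rw [iteratedFDeriv_succ_apply_eq_fderiv (hat p hp)] at hu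
  set v := Fin.tail u
  set ψ : Euc n → (Fin N → ℝ) := fun y => iteratedFDeriv ℝ m φ y v with hψ
  have hψs : ∀ x ∈ U, ContDiffAt ℝ (⊤ : ℕ∞) ψ x := fun x hx =>
    contDiffAt_iteratedFDeriv_apply (hat x hx) v
  have hL : (fderiv ℝ ψ p).toLinearMap ≠ 0 := fun h0 => hu (DFunLike.congr_fun h0 (u 0))
  let c (j : Fin n) (l : Fin N) : (Euc n →L[ℝ] (Fin N → ℝ)) →L[ℝ] ℝ :=
    (ContinuousLinearMap.proj l).comp
      (ContinuousLinearMap.apply ℝ (Fin N → ℝ) (EuclideanSpace.single j (1 : ℝ)))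
  have hdφ : ContDiffOn ℝ (⊤ : ℕ∞) (fderiv ℝ φ) U :=
    hφ.fderiv_of_isOpen hU (by simp)
  have hc : ∀ j l, ContDiffOn ℝ (⊤ : ℕ∞) (c j l ∘ fderiv ℝ φ) U := fun j l =>
    (c j l).contDiff.comp_contDiffOn hdφ
  have hcD : ∀ j l i, iteratedFDeriv ℝ i (c j l ∘ fderiv ℝ φ) p =
      (c j l).compContinuousMultilinearMap (iteratedFDeriv ℝ i (fderiv ℝ φ) p) := fun j l i =>
    (c j l).iteratedFDeriv_comp_left (hdφ.contDiffAt hU') (by exact_mod_cast le_top)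
  have hcv : ∀ j l, ∀ i < m, iteratedFDeriv ℝ i (c j l ∘ fderiv ℝ φ) p = 0 := by
    intro j l i hi
    have h0 : iteratedFDeriv ℝ i (fderiv ℝ φ) p = 0 := by
      rw [← norm_eq_zero, norm_iteratedFDeriv_fderiv, hv _ hi, norm_zero]
    rw [hcD, h0]
    ext
    simp
  have hAL : ∑ j, (A j p).mulVec
      ((fderiv ℝ ψ p).toLinearMap (EuclideanSpace.single j 1)) = 0 := by
    ext i
    have hfun : (fun x => ∑ j, ∑ l, A j x i l • (c j l ∘ fderiv ℝ φ) x) =ᶠ[𝓝 p]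
        fun x => -(V x (φ x) i) := by
      filter_upwards [hU'] with x hx
      have h := congrFun (heq x hx) i
      simp only [semilinApply, Pi.add_apply, Finset.sum_apply, Matrix.mulVec, dotProduct,
        Pi.zero_apply] at h
      exact eq_neg_of_add_eq_zero_left h
    have hrhs : iteratedFDeriv ℝ m (fun x => -(V x (φ x) i)) p = 0 := by
      have hVi : ContDiffOn ℝ (⊤ : ℕ∞)
          (fun q : Euc n × (Fin N → ℝ) => -(V q.1 q.2 i)) (U ×ˢ univ) :=
        (contDiffOn_pi.1 hV i).neg
      refine iteratedFDeriv_comp_section_eq_zero (V := fun q => -(V q.1 q.2 i))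
        ((hVi.contDiffAt (prod_mem_nhds hU' univ_mem)).of_le (by exact_mod_cast le_top))
        ((hat p hp).of_le (by exact_mod_cast le_top)) ?_ hv
      filter_upwards [hU'] with x hx
      simp [hV0 x hx]
    have hterm : ∀ j l, ContDiffAt ℝ m
        (fun x => A j x i l • (c j l ∘ fderiv ℝ φ) x) p := fun j l =>
      (((hA j i l).smul (hc j l)).contDiffAt hU').of_le (by exact_mod_cast le_top)
    have hD := (hfun.iteratedFDeriv ℝ m).self_of_nhds
    rw [hrhs, iteratedFDeriv_fun_sum_apply fun j _ => ContDiffAt.sum fun l _ => hterm j l] at hD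
    simp_rw [iteratedFDeriv_fun_sum_apply fun l _ => hterm _ l,
      iteratedFDeriv_smul_of_vanishing hU (hA _ i _) (hc _ _) hp (hcv _ _), hcD] at hD
    have hDv := DFunLike.congr_fun hD v
    simp only [_root_.sum_apply, _root_.smul_apply] at hDv
    simp only [Finset.sum_apply, Matrix.mulVec, dotProduct, Pi.zero_apply]
    refine Eq.trans ?_ hDv
    refine Finset.sum_congr rfl fun j _ => Finset.sum_congr rfl fun l _ => ?_
    have := congrFun (iteratedFDeriv_fderiv_apply hU hφ (EuclideanSpace.single j 1) m p hp v) l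
    exact congrArg (A j p i l * ·) this.symm
  obtain ⟨P, hP⟩ := exists_surjective_comp_of_elliptic (hell p hp) hL hAL
  let P' : (Fin N → ℝ) →L[ℝ] (Fin 2 → ℝ) := LinearMap.toContinuousLinearMap P
  have hg : ∀ᶠ x in 𝓝 p, ContDiffAt ℝ (⊤ : ℕ∞) (P' ∘ ψ) x := by
    filter_upwards [hU'] with x hx using P'.contDiff.contDiffAt.comp x (hψs x hx)
  have hgs : Function.Surjective (fderiv ℝ (P' ∘ ψ) p) := by
    rw [(P'.hasFDerivAt.comp p ((hψs p hp).differentiableAt (by simp)).hasFDerivAt).fderiv]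
    exact hP
  obtain ⟨h, hh, W, hW, hsub⟩ := exists_contDiff_zeroSet_subset_range (m := n - 2)
    (by simp; omega) hg hgs
  refine ⟨h, hh, W, hW, fun x hx => hsub ⟨hx.1, ?_⟩⟩
  have hx0 : iteratedFDeriv ℝ m φ x = 0 := hx.2
  simp [hψ, hx0]

/-- A set covered locally by ranges of smooth maps is countably rectifiable. -/
theorem countablyCinfRectifiable_of_locally {n m : ℕ} {S : Set (Euc n)}
    (h : ∀ p ∈ S, ∃ g : Euc m → Euc n, ContDiff ℝ (⊤ : ℕ∞) g ∧ range g ∈ 𝓝[S] p) :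
    CountablyCinfRectifiable m S := by
  choose! g hg hgS using h
  obtain ⟨t, htS, htc, hcov⟩ := TopologicalSpace.countable_cover_nhdsWithin hgS
  rcases t.eq_empty_or_nonempty with rfl | hne
  · exact ⟨fun _ _ => 0, fun _ => contDiff_const, hcov.trans (by simp)⟩
  · obtain ⟨q, rfl⟩ := htc.exists_eq_range hne
    exact ⟨fun i => g (q i), fun i => hg _ (htS ⟨i, rfl⟩), by simpa using hcov⟩

/-- Countable unions of countably rectifiable sets are countably rectifiable. -/
theorem CountablyCinfRectifiable.iUnion {n m : ℕ} {S : ℕ → Set (Euc n)}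
    (h : ∀ k, CountablyCinfRectifiable m (S k)) : CountablyCinfRectifiable m (⋃ k, S k) := by
  choose g hg hS using h
  refine ⟨fun i => g i.unpair.1 i.unpair.2, fun i => hg _ _, iUnion_subset fun k x hx => ?_⟩
  obtain ⟨i, hi⟩ := mem_iUnion.1 (hS k hx)
  exact mem_iUnion.2 ⟨Nat.pair k i, by simpa using hi⟩

/-- A countably `m`-rectifiable set has Hausdorff dimension at most `m`. -/
theorem CountablyCinfRectifiable.dimH_le {n m : ℕ} {S : Set (Euc n)}
    (h : CountablyCinfRectifiable m S) : dimH S ≤ m := by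
  obtain ⟨g, hg, hS⟩ := h
  refine (dimH_mono hS).trans ?_
  rw [dimH_iUnion]
  exact iSup_le fun i => by
    simpa using ((hg i).of_le (by exact_mod_cast le_top)).dimH_range_le

/-- For a nontrivial smooth solution `φ` of a semilinear elliptic
first-order system respecting the zero section on a connected open set `U ⊆ ℝⁿ`, `n ≥ 2`,
the set `N_fin(φ)` of zeros of finite order is countably `(n−2)`-`C^∞`-rectifiable;
in particular its Hausdorff dimension is at most `n − 2`. -/
theorem finite_order_zero_set_countably_rectifiable
    (n N : ℕ) (hn : 2 ≤ n) (hN : 1 ≤ N)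
    (U : Set (Euc n)) (hUopen : IsOpen U) (hUconn : IsConnected U)
    (A : Fin n → Euc n → Matrix (Fin N) (Fin N) ℝ)
    (hA : ∀ j i l, ContDiffOn ℝ (⊤ : ℕ∞) (fun x => A j x i l) U)
    (hell : IsElliptic A U)
    (V : Euc n → (Fin N → ℝ) → (Fin N → ℝ))
    (hV : ContDiffOn ℝ (⊤ : ℕ∞) (fun p : Euc n × (Fin N → ℝ) => V p.1 p.2) (U ×ˢ univ))
    (hV0 : ∀ x ∈ U, V x 0 = 0)
    (φ : Euc n → (Fin N → ℝ)) (hφ : ContDiffOn ℝ (⊤ : ℕ∞) φ U)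
    (heq : ∀ x ∈ U, semilinApply A V φ x = 0)
    (hnontriv : ∃ x ∈ U, φ x ≠ 0) :
    CountablyCinfRectifiable (n - 2)
        {x ∈ U | φ x = 0 ∧ ∃ k, iteratedFDeriv ℝ k φ x ≠ 0} ∧
      dimH {x ∈ U | φ x = 0 ∧ ∃ k, iteratedFDeriv ℝ k φ x ≠ 0} ≤ (n : ℝ≥0∞) - 2 := by
  have hrect : CountablyCinfRectifiable (n - 2)
      {x ∈ U | φ x = 0 ∧ ∃ k, iteratedFDeriv ℝ k φ x ≠ 0} := by
    let S (m : ℕ) : Set (Euc n) := {x ∈ U | (∀ i ≤ m, iteratedFDeriv ℝ i φ x = 0) ∧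
      iteratedFDeriv ℝ (m + 1) φ x ≠ 0}
    have hS : ∀ m, CountablyCinfRectifiable (n - 2) (S m) := fun m =>
      countablyCinfRectifiable_of_locally fun p hp => by
        obtain ⟨h, hh, W, hW, hsub⟩ := exists_contDiff_iteratedFDeriv_zeroSet_subset_range hn hUopen hA
          hell hV hV0 hφ heq hp.1 hp.2.1 hp.2.2
        refine ⟨h, hh, mem_nhdsWithin_iff_exists_mem_nhds_inter.2 ⟨W, hW, fun x hx => ?_⟩⟩
        exact hsub ⟨hx.1, hx.2.2.1 m le_rfl⟩
    obtain ⟨g, hg, hcov⟩ := CountablyCinfRectifiable.iUnion hS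
    refine ⟨g, hg, Subset.trans ?_ hcov⟩
    classical
    rintro x ⟨hxU, hx0, hk⟩
    have hmin : ∀ i < Nat.find hk, iteratedFDeriv ℝ i φ x = 0 := fun i hi =>
      not_not.1 (Nat.find_min hk hi)
    obtain ⟨m, hm⟩ : ∃ m, Nat.find hk = m + 1 := by
      refine Nat.exists_eq_succ_of_ne_zero fun h0 => ?_
      have h := Nat.find_spec hk
      rw [h0] at h
      refine h (ContinuousMultilinearMap.ext fun v => ?_)
      simp [hx0]
    exact mem_iUnion.2 ⟨m, hxU, fun i hi => hmin i (by omega), hm ▸ Nat.find_spec hk⟩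
  exact ⟨hrect, by simpa using hrect.dimH_le⟩
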